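/- arXiv:1608.00922 — 2 statements merged into one kernel-verified Lean document; each statement's English description precedes it below -/
import Mathlib

section
/- Let A be a commutative ring, 𝔐 ⊆ A an ideal, and f ∈ 𝔐 a non-zero-divisor. Call an A-module M good if neither M nor M/fM contains a non-zero element annihilated by 𝔐. If α : M → N is a homomorphism of A-modules such that 𝔐·ker(α) = 0 and 𝔐·coker(α) = 0, and M is good, then the induced map M/M[f] → N/N[f] is an isomorphism. -/
/-- **Statement 1.** Let `𝔐 ⊆ A` be an ideal and `f ∈ 𝔐` a non-zero-divisor.  Call a module `M`
"good" if neither `M` nor `M/fM` contains a non-zero element annihilated by `𝔐`.  If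
`α : M → N` has kernel and cokernel killed by `𝔐` and `M` is good, then the induced map
`M/M[f] → N/N[f]` is an isomorphism. -/
theorem statement1 {A : Type*} [CommRing A] (𝔐 : Ideal A) (f : A) (hf𝔐 : f ∈ 𝔐)
    (hf : ∀ a : A, f * a = 0 → a = 0)
    {M N : Type*} [AddCommGroup M] [Module A M] [AddCommGroup N] [Module A N]
    (α : M →ₗ[A] N)
    (hker : ∀ m ∈ LinearMap.ker α, ∀ a ∈ 𝔐, a • m = 0)
    (hcoker : ∀ (n : N), ∀ a ∈ 𝔐, a • n ∈ LinearMap.range α)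
    (hgood1 : ∀ m : M, (∀ a ∈ 𝔐, a • m = 0) → m = 0)
    (hgood2 : ∀ m : M, (∀ a ∈ 𝔐, ∃ m', a • m = f • m') → ∃ m', m = f • m') :
    Function.Bijective
      (Submodule.mapQ (Submodule.torsionBy A M f) (Submodule.torsionBy A N f) α
        (fun m hm => by
          rw [Submodule.mem_torsionBy_iff] at hm
          rw [Submodule.mem_comap, Submodule.mem_torsionBy_iff, ← map_smul, hm, map_zero])) := by
  have hinj : Function.Injective α := by
    rw [← LinearMap.ker_eq_bot, LinearMap.ker_eq_bot']
    exact fun m hm => hgood1 m (hker m hm)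
  constructor
  · rw [← LinearMap.ker_eq_bot, LinearMap.ker_eq_bot']
    intro x hx
    obtain ⟨m, rfl⟩ := Submodule.Quotient.mk_surjective _ x
    rw [Submodule.mapQ_apply, Submodule.Quotient.mk_eq_zero, Submodule.mem_torsionBy_iff,
      ← map_smul] at hx
    rw [Submodule.Quotient.mk_eq_zero, Submodule.mem_torsionBy_iff]
    exact hinj (hx.trans (map_zero α).symm)
  · intro y
    obtain ⟨n, rfl⟩ := Submodule.Quotient.mk_surjective _ y
    obtain ⟨m, hm⟩ := hcoker n f hf𝔐
    obtain ⟨m', rfl⟩ := hgood2 m fun a ha => by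
      obtain ⟨b, hb⟩ := hcoker n a ha
      exact ⟨b, hinj (by rw [map_smul, map_smul, hm, hb, smul_comm])⟩
    refine ⟨Submodule.Quotient.mk m', ?_⟩
    rw [Submodule.mapQ_apply, Submodule.Quotient.eq, Submodule.mem_torsionBy_iff, smul_sub,
      ← map_smul, hm, sub_self]
end

section
/- Let p be a prime, r ≥ 1 an integer, and A a commutative p-torsion-free ring containing a root ζ of the p^r-th cyclotomic polynomial. Then in the truncated Witt vector ring W_r(A): the element [ζ] − 1 is a non-zero-divisor, [ζ] − 1 divides p^r, and ([ζ] − 1)^{p^r − 1} is divisible by p. -/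
open Finset in
/-- A ghost component vanishes when all Witt components entering it do. -/
theorem WittVector.ghostComponent_eq_zero_of_coeff_eq_zero {p : ℕ} [Fact p.Prime]
    {A : Type*} [CommRing A] {x : WittVector p A} {n : ℕ} (h : ∀ i ≤ n, x.coeff i = 0) :
    WittVector.ghostComponent n x = 0 := by
  have hp : p ≠ 0 := (Fact.out : p.Prime).ne_zero
  rw [WittVector.ghostComponent_apply, wittPolynomial_eq_sum_C_mul_X_pow, map_sum]
  refine sum_eq_zero fun i hi => ?_
  simp [h i (by simpa [Nat.lt_succ_iff] using hi), hp]

open Finset in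
/-- Over a `p`-torsion-free ring, the first `r` ghost components determine whether the first `r`
Witt components vanish. -/
theorem WittVector.coeff_eq_zero_of_ghostComponent_eq_zero {p : ℕ} [Fact p.Prime]
    {A : Type*} [CommRing A] (hptf : ∀ a : A, (p : A) * a = 0 → a = 0) {x : WittVector p A} {r : ℕ}
    (h : ∀ i < r, WittVector.ghostComponent i x = 0) : ∀ i < r, x.coeff i = 0 := by
  have hp : p ≠ 0 := (Fact.out : p.Prime).ne_zero
  have hpow : ∀ (n : ℕ) (a : A), (p : A) ^ n * a = 0 → a = 0 := by
    intro n
    induction n with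
    | zero => simp
    | succ n ih => exact fun a ha => hptf a (ih _ (by rw [← ha]; ring))
  intro i
  induction i using Nat.strong_induction_on with
  | _ i ih =>
    intro hi
    have hg := h i hi
    rw [WittVector.ghostComponent_apply, wittPolynomial_eq_sum_C_mul_X_pow, map_sum,
      sum_range_succ, sum_eq_zero] at hg
    · exact hpow i _ (by simpa using hg)
    · intro j hj
      rw [mem_range] at hj
      simp [ih j hj (hj.trans hi), hp]

/-- If the first `r` ghost components of a Witt vector over a `p`-torsion-free ring are
non-zero-divisors, so is its truncation to length `r`. -/
theorem WittVector.eq_zero_of_truncate_mul_eq_zero {p : ℕ} [Fact p.Prime]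
    {A : Type*} [CommRing A] (hptf : ∀ a : A, (p : A) * a = 0 → a = 0) {r : ℕ} {t : WittVector p A}
    (ht : ∀ i < r, ∀ a : A, WittVector.ghostComponent i t * a = 0 → a = 0)
    (x : TruncatedWittVector p r A) (hx : WittVector.truncate r t * x = 0) : x = 0 := by
  obtain ⟨y, rfl⟩ := WittVector.truncate_surjective p r A x
  rw [← map_mul, ← RingHom.mem_ker, WittVector.mem_ker_truncate] at hx
  rw [← RingHom.mem_ker, WittVector.mem_ker_truncate]
  refine WittVector.coeff_eq_zero_of_ghostComponent_eq_zero hptf fun i hi => ht i hi _ ?_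
  rw [← map_mul]
  exact WittVector.ghostComponent_eq_zero_of_coeff_eq_zero fun j hj => hx j (hj.trans_lt hi)

/-- In any commutative ring, `1 + t + ⋯ + t ^ (p ^ r - 1)` and `(t - 1) ^ (p ^ r - 1)` agree
modulo `p`. -/
theorem natCast_dvd_geom_sum_sub_pow {R : Type*} [CommRing R] (p : ℕ) [Fact p.Prime] (r : ℕ)
    (t : R) : (p : R) ∣ ∑ i ∈ Finset.range (p ^ r), t ^ i - (t - 1) ^ (p ^ r - 1) := by
  have hq : p ^ r - 1 + 1 = p ^ r := Nat.sub_add_cancel (Nat.pow_pos (Fact.out : p.Prime).pos)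
  have key : (∑ i ∈ Finset.range (p ^ r), (Polynomial.X : Polynomial (ZMod p)) ^ i) =
      (Polynomial.X - 1) ^ (p ^ r - 1) := by
    have hne : (Polynomial.X - 1 : Polynomial (ZMod p)) ≠ 0 := by
      simpa using Polynomial.X_sub_C_ne_zero (1 : ZMod p)
    refine mul_right_cancel₀ hne ?_
    rw [geom_sum_mul, ← pow_succ, hq, sub_pow_char_pow, one_pow]
  have hdvd : (Polynomial.C (p : ℤ)) ∣
      ∑ i ∈ Finset.range (p ^ r), Polynomial.X ^ i - (Polynomial.X - 1) ^ (p ^ r - 1) := by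
    rw [Polynomial.C_dvd_iff_dvd_coeff]
    intro n
    rw [← ZMod.intCast_zmod_eq_zero_iff_dvd, ← eq_intCast (Int.castRingHom (ZMod p)),
      ← Polynomial.coeff_map]
    simp [Polynomial.map_sum, key]
  simpa using map_dvd (Polynomial.aeval t) hdvd

/-- **Statement 12.** Let `p` be prime, `r ≥ 1`, `A` a `p`-torsion-free commutative ring and
`ζ ∈ A` a root of the `p^r`-th cyclotomic polynomial `∑_{i<p} X^{i·p^{r-1}}`.  Then in
`W_r(A)`: `[ζ] - 1` is a non-zero-divisor, `[ζ] - 1` divides `p^r`, and `p` divides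
`([ζ] - 1)^{p^r - 1}`. -/
theorem statement12 (p : ℕ) [Fact p.Prime] (r : ℕ) (hr : 1 ≤ r)
    (A : Type*) [CommRing A] (hptf : ∀ a : A, (p : A) * a = 0 → a = 0)
    (ζ : A) (hζ : ∑ i ∈ Finset.range p, ζ ^ (i * p ^ (r - 1)) = 0) :
    (∀ x : TruncatedWittVector p r A,
        (WittVector.truncate r (WittVector.teichmuller p ζ) - 1) * x = 0 → x = 0) ∧
    ((WittVector.truncate r (WittVector.teichmuller p ζ) - 1) ∣
        (p : TruncatedWittVector p r A) ^ r) ∧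
    ((p : TruncatedWittVector p r A) ∣
        (WittVector.truncate r (WittVector.teichmuller p ζ) - 1) ^ (p ^ r - 1)) := by
  have hη : ∑ i ∈ Finset.range p, (ζ ^ p ^ (r - 1)) ^ i = 0 := by
    simpa only [← pow_mul, mul_comm] using hζ
  have hone : ζ ^ p ^ r = 1 := by
    have h := geom_sum_mul (ζ ^ p ^ (r - 1)) p
    rwa [hη, zero_mul, ← pow_mul, ← pow_succ, Nat.sub_add_cancel hr, eq_comm, sub_eq_zero] at h
  have hdvd : ∀ {R : Type _} [CommRing R] (t : R) (n : ℕ),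
      ∑ i ∈ Finset.range n, t ^ i = 0 → t - 1 ∣ (n : R) := by
    intro R _ t n h
    have : t - 1 ∣ ∑ i ∈ Finset.range n, (t ^ i - 1) :=
      Finset.dvd_sum fun i _ => sub_one_dvd_pow_sub_one t i
    simpa [Finset.sum_sub_distrib, h] using this
  have hnzd : ∀ x : TruncatedWittVector p r A,
      (WittVector.truncate r (WittVector.teichmuller p ζ) - 1) * x = 0 → x = 0 := by
    intro x hx
    rw [← map_one (WittVector.truncate r), ← map_sub] at hx
    refine WittVector.eq_zero_of_truncate_mul_eq_zero hptf (fun i hi a ha => hptf a ?_) x hx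
    rw [map_sub, map_one, WittVector.ghostComponent_teichmuller] at ha
    have h : ζ ^ p ^ i - 1 ∣ (p : A) :=
      (dvd_pow_sub_one_of_dvd (pow_dvd_pow p (Nat.le_sub_one_of_lt hi))).trans
        (hdvd _ p hη)
    obtain ⟨c, hc⟩ := h
    rw [hc, mul_right_comm, ha, zero_mul]
  have hsum : ∑ i ∈ Finset.range (p ^ r),
      (WittVector.truncate r (WittVector.teichmuller p ζ)) ^ i = 0 := by
    refine hnzd _ ?_
    rw [mul_geom_sum, ← map_pow, ← map_pow, hone, map_one, map_one, sub_self]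
  refine ⟨hnzd, ?_, ?_⟩
  · exact_mod_cast hdvd _ _ hsum
  · have h := natCast_dvd_geom_sum_sub_pow p r (WittVector.truncate r (WittVector.teichmuller p ζ))
    rwa [hsum, zero_sub, dvd_neg] at h
end
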